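/- Let A generate a C₀-group (T_t)_{t∈ℝ} on a Banach space X with group growth bound ω(T). Then for every a > ω(T), the set {R(λ,A) : |Re λ| ≥ a} is R-bounded (and γ-bounded); in particular A is of R-strip type with w_R(A) ≤ ω(T). -/

import Mathlib

open MeasureTheory ProbabilityTheory

/-- The Rademacher average `(E‖Σᵢ rᵢ xᵢ‖²)^{1/2}` of a finite sequence in a complex
Banach space `X`. -/
noncomputable def radAvg {X : Type*} [NormedAddCommGroup X] [NormedSpace ℂ X]
    {n : ℕ} (x : Fin n → X) : ℝ :=
  Real.sqrt (((2 : ℝ) ^ n)⁻¹ *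
    ∑ ε : Fin n → Bool, ‖∑ i, (if ε i then (1 : ℂ) else -1) • x i‖ ^ 2)

/-- The Gaussian average `(E‖Σᵢ gᵢ xᵢ‖²)^{1/2}` of a finite sequence in a complex
Banach space `X`, with `(gᵢ)` i.i.d. standard (real) Gaussians. -/
noncomputable def gaussAvg {X : Type*} [NormedAddCommGroup X] [NormedSpace ℂ X]
    {n : ℕ} (x : Fin n → X) : ℝ :=
  Real.sqrt (∫ g : Fin n → ℝ, ‖∑ i, ((g i : ℝ) : ℂ) • x i‖ ^ 2
    ∂(Measure.pi fun _ => gaussianReal 0 1))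

open scoped ENNReal

lemma enorm_sq_eq_ofReal {E : Type*} [NormedAddCommGroup E] (v : E) :
    ‖v‖ₑ ^ 2 = ENNReal.ofReal (‖v‖ ^ 2) := by
  rw [ENNReal.ofReal_pow (norm_nonneg v), ofReal_norm]

section SignSymmetric

variable {Ω : Type*} [MeasurableSpace Ω] {μ : Measure Ω} {n : ℕ} {g : Ω → Fin n → ℝ}
  {X : Type*} [NormedAddCommGroup X] [NormedSpace ℂ X]

/-- A random vector whose law is invariant under changing the sign of any single coordinate. -/
structure SignSymmetric (μ : Measure Ω) (g : Ω → Fin n → ℝ) : Prop where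
  measurable : Measurable g
  exists_flip : ∀ i, ∃ τ : Ω → Ω, MeasurePreserving τ μ μ ∧
    ∀ ω j, g (τ ω) j = if j = i then -g ω j else g ω j

/-- The second moment `E‖∑ᵢ gᵢ xᵢ‖²` as an extended nonnegative real. -/
noncomputable def sqMoment (μ : Measure Ω) (g : Ω → Fin n → ℝ) (x : Fin n → X) : ℝ≥0∞ :=
  ∫⁻ ω, ‖∑ i, ((g ω i : ℝ) : ℂ) • x i‖ₑ ^ 2 ∂μ

lemma measurable_enorm_sum_smul (hg : Measurable g) (x : Fin n → X) :
    Measurable fun ω => ‖∑ i, ((g ω i : ℝ) : ℂ) • x i‖ₑ ^ 2 := by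
  have hc : Continuous fun z : Fin n → ℝ => ‖∑ i, ((z i : ℝ) : ℂ) • x i‖ₑ ^ 2 := by fun_prop
  exact hc.measurable.comp hg

lemma sqMoment_smul (c : ℂ) (x : Fin n → X) (hg : Measurable g) :
    sqMoment μ g (c • x) = ‖c‖ₑ ^ 2 * sqMoment μ g x := by
  unfold sqMoment
  rw [← lintegral_const_mul _ (measurable_enorm_sum_smul hg x)]
  refine lintegral_congr fun ω => ?_
  have : ∑ i, ((g ω i : ℝ) : ℂ) • (c • x) i = c • ∑ i, ((g ω i : ℝ) : ℂ) • x i := by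
    rw [Finset.smul_sum]
    exact Finset.sum_congr rfl fun i _ => smul_comm _ _ _
  rw [this, enorm_smul, mul_pow]

lemma sqMoment_add_le (x y : Fin n → X) (hg : Measurable g) :
    sqMoment μ g (x + y) ≤ 2 * sqMoment μ g x + 2 * sqMoment μ g y := by
  unfold sqMoment
  have hx := measurable_enorm_sum_smul hg x
  have hy := measurable_enorm_sum_smul hg y
  rw [← lintegral_const_mul _ hx, ← lintegral_const_mul _ hy,
    ← lintegral_add_left (hx.const_mul 2)]
  refine lintegral_mono fun ω => ?_
  have hsum : ∑ i, ((g ω i : ℝ) : ℂ) • (x + y) i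
      = ∑ i, ((g ω i : ℝ) : ℂ) • x i + ∑ i, ((g ω i : ℝ) : ℂ) • y i := by
    simp [Finset.sum_add_distrib]
  rw [hsum]
  generalize ∑ i, ((g ω i : ℝ) : ℂ) • x i = u
  generalize ∑ i, ((g ω i : ℝ) : ℂ) • y i = v
  simp only [enorm_sq_eq_ofReal]
  have h2 : (2 : ℝ≥0∞) = ENNReal.ofReal 2 := by simp
  rw [h2, ← ENNReal.ofReal_mul (by norm_num), ← ENNReal.ofReal_mul (by norm_num),
    ← ENNReal.ofReal_add (by positivity) (by positivity)]
  apply ENNReal.ofReal_le_ofReal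
  have := norm_add_le u v
  nlinarith [norm_nonneg (u + v), sq_nonneg (‖u‖ - ‖v‖), norm_nonneg u, norm_nonneg v]

lemma SignSymmetric.sqMoment_update_neg (hg : SignSymmetric μ g) (x : Fin n → X) (i : Fin n) :
    sqMoment μ g (Function.update x i (-x i)) = sqMoment μ g x := by
  obtain ⟨τ, hτ, hflip⟩ := hg.exists_flip i
  unfold sqMoment
  rw [← hτ.lintegral_comp (measurable_enorm_sum_smul hg.measurable x)]
  refine lintegral_congr fun ω => ?_
  congr 3
  funext j
  rw [hflip]
  by_cases h : j = i
  · subst h; simp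
  · simp [h]

lemma SignSymmetric.sqMoment_update_smul_le (hg : SignSymmetric μ g) (x : Fin n → X) (i : Fin n)
    {c : ℝ} (hc : |c| ≤ 1) :
    sqMoment μ g (Function.update x i ((c : ℂ) • x i)) ≤ sqMoment μ g x := by
  obtain ⟨hc1, hc2⟩ := abs_le.1 hc
  set p : ℝ := (1 + c) / 2 with hp
  set q : ℝ := (1 - c) / 2 with hq
  have hp0 : 0 ≤ p := by linarith
  have hq0 : 0 ≤ q := by linarith
  have hpq : p + q = 1 := by linarith
  set x' := Function.update x i (-x i) with hx'
  have key : sqMoment μ g (Function.update x i ((c : ℂ) • x i))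
      ≤ ENNReal.ofReal p * sqMoment μ g x + ENNReal.ofReal q * sqMoment μ g x' := by
    unfold sqMoment
    have hx := measurable_enorm_sum_smul hg.measurable x
    rw [← lintegral_const_mul _ hx,
      ← lintegral_const_mul _ (measurable_enorm_sum_smul hg.measurable x'),
      ← lintegral_add_left (hx.const_mul _)]
    refine lintegral_mono fun ω => ?_
    have hsum : ∑ j, ((g ω j : ℝ) : ℂ) • Function.update x i ((c : ℂ) • x i) j
        = (p : ℂ) • (∑ j, ((g ω j : ℝ) : ℂ) • x j) + (q : ℂ) • ∑ j, ((g ω j : ℝ) : ℂ) • x' j := by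
      rw [Finset.smul_sum, Finset.smul_sum, ← Finset.sum_add_distrib]
      refine Finset.sum_congr rfl fun j _ => ?_
      by_cases h : j = i
      · subst h
        simp only [hx', Function.update_self, smul_neg, smul_smul, ← sub_eq_add_neg, ← sub_smul]
        congr 1
        rw [hp, hq]; push_cast; ring
      · simp only [hx', Function.update_of_ne h, smul_smul, ← add_smul]
        congr 1
        rw [← add_mul, ← Complex.ofReal_add, hpq]; simp
    rw [hsum]
    generalize ∑ j, ((g ω j : ℝ) : ℂ) • x j = u
    generalize ∑ j, ((g ω j : ℝ) : ℂ) • x' j = v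
    simp only [enorm_sq_eq_ofReal]
    rw [← ENNReal.ofReal_mul hp0, ← ENNReal.ofReal_mul hq0,
      ← ENNReal.ofReal_add (by positivity) (by positivity)]
    apply ENNReal.ofReal_le_ofReal
    have h := norm_add_le ((p : ℂ) • u) ((q : ℂ) • v)
    rw [norm_smul, norm_smul, Complex.norm_real, Complex.norm_real, Real.norm_of_nonneg hp0,
      Real.norm_of_nonneg hq0] at h
    calc ‖(p : ℂ) • u + (q : ℂ) • v‖ ^ 2 ≤ (p * ‖u‖ + q * ‖v‖) ^ 2 := by gcongr
      _ ≤ p * ‖u‖ ^ 2 + q * ‖v‖ ^ 2 := by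
        have hq' : q = 1 - p := by linarith
        rw [hq'] at hq0 ⊢
        nlinarith [mul_nonneg (mul_nonneg hp0 hq0) (sq_nonneg (‖u‖ - ‖v‖))]
  rw [hg.sqMoment_update_neg, ← add_mul, ← ENNReal.ofReal_add hp0 hq0, hpq] at key
  simpa using key

/-- The contraction principle for real coefficients. -/
lemma SignSymmetric.sqMoment_real_smul_le (hg : SignSymmetric μ g) (x : Fin n → X)
    {c : Fin n → ℝ} (hc : ∀ i, |c i| ≤ 1) :
    sqMoment μ g (fun i => (c i : ℂ) • x i) ≤ sqMoment μ g x := by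
  suffices h : ∀ s : Finset (Fin n),
      sqMoment μ g (fun i => if i ∈ s then (c i : ℂ) • x i else x i) ≤ sqMoment μ g x by
    simpa using h Finset.univ
  intro s
  induction s using Finset.induction_on with
  | empty => simp
  | insert i s hi ih =>
    refine le_trans (le_of_eq ?_) ((hg.sqMoment_update_smul_le _ i (hc i)).trans ih)
    congr 1
    funext j
    by_cases h : j = i
    · subst h; simp [hi]
    · simp [h]

/-- The contraction principle for complex coefficients. -/
lemma SignSymmetric.sqMoment_complex_smul_le (hg : SignSymmetric μ g) (x : Fin n → X)
    {c : Fin n → ℂ} (hc : ∀ i, ‖c i‖ ≤ 1) :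
    sqMoment μ g (fun i => c i • x i) ≤ 4 * sqMoment μ g x := by
  have hdecomp : (fun i => c i • x i)
      = (fun i => ((c i).re : ℂ) • x i) + fun i => ((c i).im : ℂ) • (Complex.I • x) i := by
    funext i
    simp only [Pi.add_apply, Pi.smul_apply, smul_smul, ← add_smul, Complex.re_add_im]
  rw [hdecomp]
  refine (sqMoment_add_le _ _ hg.measurable).trans ?_
  have h1 := hg.sqMoment_real_smul_le x (c := fun i => (c i).re)
    fun i => (Complex.abs_re_le_norm _).trans (hc i)
  have h2 := hg.sqMoment_real_smul_le (Complex.I • x) (c := fun i => (c i).im)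
    fun i => (Complex.abs_im_le_norm _).trans (hc i)
  rw [sqMoment_smul _ _ hg.measurable] at h2
  simp only [enorm_eq_nnnorm, Complex.nnnorm_I, ENNReal.coe_one, one_pow, one_mul] at h2
  calc _ ≤ 2 * sqMoment μ g x + 2 * sqMoment μ g x := by gcongr
    _ = 4 * sqMoment μ g x := by rw [← add_mul]; norm_num

lemma sq_lintegral_mul_le {α : Type*} [MeasurableSpace α] {ν : Measure α} {φ W : α → ℝ≥0∞}
    (hφ : Measurable φ) (hW : Measurable W) :
    (∫⁻ t, φ t * W t ∂ν) ^ 2 ≤ (∫⁻ t, φ t ∂ν) * ∫⁻ t, φ t * W t ^ 2 ∂ν := by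
  have h := ENNReal.lintegral_mul_norm_pow_le (μ := ν) hφ.aemeasurable
    (hφ.mul (hW.pow_const 2)).aemeasurable (p := 1 / 2) (q := 1 / 2) (by norm_num) (by norm_num)
    (by norm_num)
  have hpt : ∀ t, φ t ^ (1 / 2 : ℝ) * (φ t * W t ^ 2) ^ (1 / 2 : ℝ) = φ t * W t := fun t => by
    rw [ENNReal.mul_rpow_of_nonneg _ _ (by norm_num), ← mul_assoc,
      ← ENNReal.rpow_add_of_nonneg _ _ (by norm_num) (by norm_num), ← ENNReal.rpow_natCast,
      ← ENNReal.rpow_mul]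
    norm_num
  simp only [Pi.mul_apply, hpt] at h
  have hsq : ∀ a : ℝ≥0∞, (a ^ (1 / 2 : ℝ)) ^ 2 = a := fun a => by
    rw [← ENNReal.rpow_natCast, ← ENNReal.rpow_mul]; norm_num
  calc _ ≤ _ := pow_le_pow_left' h 2
    _ = _ := by rw [mul_pow, hsq, hsq]

/-- Integral means `∫ h(t) N(t) dt` with `|h| ≤ 1` and `‖N(t)‖ ≤ φ(t)`, `φ` integrable, are
bounded with respect to second moments of sign-symmetric random vectors. -/
lemma SignSymmetric.sqMoment_integral_le [SFinite μ] (hg : SignSymmetric μ g)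
    {N : ℝ → X →L[ℂ] X} (hN : ∀ x, Continuous fun t => N t x) {φ : ℝ → ℝ} (hφ : Measurable φ)
    (hφi : Integrable φ) (hNφ : ∀ t, ‖N t‖ ≤ φ t) {h : Fin n → ℝ → ℂ}
    (hm : ∀ i, Measurable (h i)) (hh : ∀ i t, ‖h i t‖ ≤ 1) (x : Fin n → X) :
    sqMoment μ g (fun i => ∫ t, h i t • N t (x i))
      ≤ 4 * (∫⁻ t, ENNReal.ofReal (φ t)) ^ 2 * sqMoment μ g x := by
  set W : Ω → ℝ → ℝ≥0∞ := fun ω t => ‖∑ i, ((g ω i : ℝ) : ℂ) • h i t • x i‖ₑ with hW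
  set Φ : ℝ → ℝ≥0∞ := fun t => ENNReal.ofReal (φ t) with hΦ
  have hΦm : Measurable Φ := hφ.ennreal_ofReal
  have hWm : Measurable (Function.uncurry W) := by
    have hc : Continuous fun z : (Fin n → ℝ) × (Fin n → ℂ) =>
      ‖∑ i, ((z.1 i : ℝ) : ℂ) • z.2 i • x i‖ₑ := by fun_prop
    refine hc.measurable.comp (Measurable.prodMk (hg.measurable.comp measurable_fst) ?_)
    exact measurable_pi_lambda _ fun i => (hm i).comp measurable_snd
  have hint : ∀ i, Integrable fun t => h i t • N t (x i) := fun i => by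
    refine (hφi.mul_const ‖x i‖).mono'
      ((hm i).aestronglyMeasurable.smul (hN (x i)).aestronglyMeasurable) (.of_forall fun t => ?_)
    rw [norm_smul]
    calc ‖h i t‖ * ‖N t (x i)‖ ≤ 1 * (φ t * ‖x i‖) := by
          gcongr
          · exact hh i t
          · exact (N t).le_of_opNorm_le (hNφ t) _
      _ = _ := one_mul _
  have hsum : ∀ ω, ∑ i, ((g ω i : ℝ) : ℂ) • ∫ t, h i t • N t (x i)
      = ∫ t, ∑ i, ((g ω i : ℝ) : ℂ) • h i t • N t (x i) := fun ω => by
    simp_rw [← integral_smul]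
    exact (integral_finsetSum _ fun i _ => (hint i).smul ((g ω i : ℝ) : ℂ)).symm
  have hpt : ∀ ω, ‖∑ i, ((g ω i : ℝ) : ℂ) • ∫ t, h i t • N t (x i)‖ₑ ^ 2
      ≤ (∫⁻ t, Φ t) * ∫⁻ t, Φ t * W ω t ^ 2 := fun ω => by
    refine le_trans (pow_le_pow_left' ?_ 2)
      (sq_lintegral_mul_le hΦm (hWm.comp measurable_prodMk_left))
    rw [hsum ω]
    refine (enorm_integral_le_lintegral_enorm _).trans (lintegral_mono fun t => ?_)
    have : ∑ i, ((g ω i : ℝ) : ℂ) • h i t • N t (x i)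
        = N t (∑ i, ((g ω i : ℝ) : ℂ) • h i t • x i) := by simp [map_sum]
    simp only [this, hW, hΦ]
    rw [← ofReal_norm, ← ofReal_norm, ← ENNReal.ofReal_mul ((norm_nonneg _).trans (hNφ t))]
    exact ENNReal.ofReal_le_ofReal ((N t).le_of_opNorm_le (hNφ t) _)
  have hmeas : Measurable (Function.uncurry fun ω t => Φ t * W ω t ^ 2) :=
    (hΦm.comp measurable_snd).mul (hWm.pow_const 2)
  calc sqMoment μ g (fun i => ∫ t, h i t • N t (x i))
      ≤ ∫⁻ ω, ((∫⁻ t, Φ t) * ∫⁻ t, Φ t * W ω t ^ 2) ∂μ := lintegral_mono hpt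
    _ = (∫⁻ t, Φ t) * ∫⁻ t, Φ t * sqMoment μ g (fun i => h i t • x i) := by
      rw [lintegral_const_mul _ hmeas.lintegral_prod_right,
        lintegral_lintegral_swap hmeas.aemeasurable]
      congr 1
      refine lintegral_congr fun t => ?_
      exact lintegral_const_mul (Φ t) (measurable_enorm_sum_smul hg.measurable fun i => h i t • x i)
    _ ≤ (∫⁻ t, Φ t) * ∫⁻ t, Φ t * (4 * sqMoment μ g x) := by
      gcongr with t
      exact hg.sqMoment_complex_smul_le x fun i => hh i t
    _ = 4 * (∫⁻ t, Φ t) ^ 2 * sqMoment μ g x := by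
      rw [lintegral_mul_const _ hΦm]; ring

lemma sqMoment_ne_top (hg : ∀ i, MemLp (fun ω => g ω i) 2 μ) (x : Fin n → X) :
    sqMoment μ g x ≠ ∞ := by
  have h : MemLp (fun ω => ∑ i, ((g ω i : ℝ) : ℂ) • x i) 2 μ := by
    refine memLp_finsetSum _ fun i _ => ?_
    refine ((hg i).norm.mul_const ‖x i‖).mono ?_ (.of_forall fun ω => ?_)
    · have hc : Continuous fun r : ℝ => (r : ℂ) • x i := by fun_prop
      exact hc.comp_aestronglyMeasurable (hg i).1
    · simp [norm_smul]
  have := lintegral_rpow_enorm_lt_top_of_eLpNorm_lt_top (by norm_num) (by norm_num) h.2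
  simpa [sqMoment] using this.ne

lemma integral_norm_sq_eq_toReal_sqMoment (hg : Measurable g) (x : Fin n → X) :
    ∫ ω, ‖∑ i, ((g ω i : ℝ) : ℂ) • x i‖ ^ 2 ∂μ = (sqMoment μ g x).toReal := by
  have hc : Continuous fun z : Fin n → ℝ => ‖∑ i, ((z i : ℝ) : ℂ) • x i‖ ^ 2 := by fun_prop
  rw [integral_eq_lintegral_of_nonneg_ae (.of_forall fun ω => by positivity)
    (hc.comp_aestronglyMeasurable hg.aestronglyMeasurable)]
  simp only [sqMoment, enorm_sq_eq_ofReal]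

end SignSymmetric

section Averages

variable {n : ℕ} {X : Type*} [NormedAddCommGroup X] [NormedSpace ℂ X]

lemma signSymmetric_gaussian :
    SignSymmetric (Measure.pi fun _ : Fin n => gaussianReal 0 1) (fun g => g) where
  measurable := measurable_id
  exists_flip i := by
    refine ⟨fun g j => (if j = i then fun r => -r else id) (g j),
      measurePreserving_pi _ _ fun j => ?_, fun ω j => by by_cases h : j = i <;> simp [h]⟩
    by_cases h : j = i
    · simp only [h, if_true]
      exact ⟨measurable_neg, by rw [gaussianReal_map_neg, neg_zero]⟩
    · simp only [h, if_false]
      exact MeasurePreserving.id _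

/-- The Rademacher vector on the discrete cube. -/
def rademacherVector (ε : Fin n → Bool) (i : Fin n) : ℝ := if ε i then 1 else -1

lemma signSymmetric_rademacher :
    SignSymmetric (Measure.count : Measure (Fin n → Bool)) rademacherVector where
  measurable := measurable_of_finite _
  exists_flip i := by
    have hinv : Function.Involutive fun ε : Fin n → Bool => Function.update ε i (!ε i) :=
      fun ε => by simp
    refine ⟨fun ε => Function.update ε i (!ε i), ⟨measurable_of_finite _, ?_⟩, fun ε j => ?_⟩
    · ext s hs
      rw [Measure.map_apply (measurable_of_finite _) hs, Measure.count_apply hs,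
        Measure.count_apply (measurable_of_finite _ hs), ← hinv.image_eq_preimage_symm,
        hinv.injective.encard_image]
    · by_cases h : j = i
      · subst h; cases hε : ε j <;> simp [rademacherVector, hε]
      · simp [rademacherVector, h]

lemma gaussAvg_eq (x : Fin n → X) : gaussAvg x =
    √(sqMoment (Measure.pi fun _ : Fin n => gaussianReal 0 1) (fun g => g) x).toReal := by
  rw [gaussAvg, ← integral_norm_sq_eq_toReal_sqMoment measurable_id']

lemma radAvg_eq (x : Fin n → X) : radAvg x =
    √(((2 : ℝ) ^ n)⁻¹ * (sqMoment Measure.count rademacherVector x).toReal) := by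
  rw [radAvg, ← integral_norm_sq_eq_toReal_sqMoment (measurable_of_finite _)]
  congr 2
  rw [integral_fintype .of_finite]
  refine Finset.sum_congr rfl fun ε _ => ?_
  simp only [Measure.real, Measure.count_singleton, ENNReal.toReal_one, one_smul]
  congr 3
  funext i
  cases h : ε i <;> simp [rademacherVector, h]

lemma gaussAvg_le_of_sqMoment_le {x y : Fin n → X} {K : ℝ} (hK : 0 ≤ K)
    (h : sqMoment (Measure.pi fun _ : Fin n => gaussianReal 0 1) (fun g => g) y ≤
      ENNReal.ofReal (K ^ 2) *
        sqMoment (Measure.pi fun _ : Fin n => gaussianReal 0 1) (fun g => g) x) :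
    gaussAvg y ≤ K * gaussAvg x := by
  rw [gaussAvg_eq, gaussAvg_eq, ← Real.sqrt_sq hK, ← Real.sqrt_mul (sq_nonneg K)]
  apply Real.sqrt_le_sqrt
  have hfin : sqMoment (Measure.pi fun _ : Fin n => gaussianReal 0 1) (fun g => g) x ≠ ∞ :=
    sqMoment_ne_top (fun i => (memLp_id_gaussianReal' 2 (by norm_num)).comp_measurePreserving
      (measurePreserving_eval (fun _ : Fin n => gaussianReal 0 1) i)) x
  have := ENNReal.toReal_mono (ENNReal.mul_ne_top ENNReal.ofReal_ne_top hfin) h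
  rwa [ENNReal.toReal_mul, ENNReal.toReal_ofReal (sq_nonneg K)] at this

lemma radAvg_le_of_sqMoment_le {x y : Fin n → X} {K : ℝ} (hK : 0 ≤ K)
    (h : sqMoment Measure.count rademacherVector y ≤
      ENNReal.ofReal (K ^ 2) * sqMoment Measure.count rademacherVector x) :
    radAvg y ≤ K * radAvg x := by
  rw [radAvg_eq, radAvg_eq, ← Real.sqrt_sq hK, ← Real.sqrt_mul (sq_nonneg K)]
  apply Real.sqrt_le_sqrt
  have hfin : sqMoment Measure.count rademacherVector x ≠ ∞ :=
    sqMoment_ne_top (fun i => .of_discrete) x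
  have := ENNReal.toReal_mono (ENNReal.mul_ne_top ENNReal.ofReal_ne_top hfin) h
  rw [ENNReal.toReal_mul, ENNReal.toReal_ofReal (sq_nonneg K)] at this
  rw [mul_left_comm]
  gcongr

end Averages

lemma integrable_exp_neg_mul_abs {c : ℝ} (hc : 0 < c) :
    Integrable fun t : ℝ => Real.exp (-(c * |t|)) := by
  rw [← integrableOn_univ, ← Set.Iic_union_Ioi (a := (0 : ℝ)), integrableOn_union]
  constructor
  · refine (integrableOn_exp_mul_Iic hc 0).congr_fun (fun t ht => ?_) measurableSet_Iic
    simp [abs_of_nonpos (Set.mem_Iic.1 ht)]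
  · refine (integrableOn_exp_mul_Ioi (neg_neg_of_pos hc) 0).congr_fun (fun t ht => ?_)
      measurableSet_Ioi
    simp [abs_of_pos (Set.mem_Ioi.1 ht)]

/-- The kernel `h` for which `R(λ, A) x = ∫ h(t) e^{-a|t|} T_t x dt` over the whole line. -/
noncomputable def resolventKernel (a : ℝ) (lam : ℂ) (t : ℝ) : ℂ :=
  if a ≤ lam.re then (if 0 < t then Complex.exp (-((lam - a) * t)) else 0)
  else if t ≤ 0 then -Complex.exp (-((lam + a) * t)) else 0

lemma measurable_resolventKernel (a : ℝ) (lam : ℂ) : Measurable (resolventKernel a lam) := by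
  unfold resolventKernel
  by_cases h : a ≤ lam.re
  · simp only [h, if_true]
    exact Measurable.ite measurableSet_Ioi (by fun_prop) measurable_const
  · simp only [h, if_false]
    exact Measurable.ite measurableSet_Iic (by fun_prop) measurable_const

lemma norm_resolventKernel_le {a : ℝ} {lam : ℂ} (h : a ≤ |lam.re|) (t : ℝ) :
    ‖resolventKernel a lam t‖ ≤ 1 := by
  unfold resolventKernel
  split_ifs with h1 h2 h2
  · rw [Complex.norm_exp, Real.exp_le_one_iff]
    simp
    nlinarith
  · simp
  · have h3 : a ≤ -lam.re := (le_abs.1 h).resolve_left h1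
    rw [norm_neg, Complex.norm_exp, Real.exp_le_one_iff]
    simp
    nlinarith
  · simp

lemma nonneg_of_group_growth {X : Type*} [NormedAddCommGroup X] [NormedSpace ℂ X] [Nontrivial X]
    {T : ℝ → X →L[ℂ] X} (hT0 : T 0 = ContinuousLinearMap.id ℂ X)
    (hTadd : ∀ s t : ℝ, T (s + t) = T s ∘L T t) {b M : ℝ}
    (hM : ∀ t : ℝ, ‖T t‖ ≤ M * Real.exp (b * |t|)) : 0 ≤ b := by
  by_contra! hb
  have h1 : ∀ t : ℝ, 0 ≤ t → 1 ≤ M * M * Real.exp (2 * b * t) := fun t ht => by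
    have h : ‖T (t + -t)‖ ≤ ‖T t‖ * ‖T (-t)‖ := by
      rw [hTadd]; exact ContinuousLinearMap.opNorm_comp_le _ _
    rw [add_neg_cancel, hT0, ContinuousLinearMap.norm_id] at h
    refine h.trans ((mul_le_mul (hM t) (hM (-t)) (norm_nonneg _)
      ((norm_nonneg _).trans (hM t))).trans_eq ?_)
    rw [abs_neg, abs_of_nonneg ht, mul_mul_mul_comm, ← Real.exp_add]
    ring_nf
  have hlim : Filter.Tendsto (fun t : ℝ => M * M * Real.exp (2 * b * t)) Filter.atTop (nhds 0) := by
    have := (Real.tendsto_exp_atBot.comp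
      (Filter.tendsto_id.const_mul_atTop_of_neg (by linarith : 2 * b < 0))).const_mul (M * M)
    simpa [Function.comp_def] using this
  have := ge_of_tendsto hlim (Filter.eventually_atTop.2 ⟨0, h1⟩)
  linarith

/-- If `A` generates a `C₀`-group `(T_t)` with growth bound `ω(T)`, then for every
`a > ω(T)` the resolvent family `{R(λ,A) : |Re λ| ≥ a}` is R-bounded and γ-bounded;
in particular `A` is of R-strip type with `w_R(A) ≤ ω(T)`. -/
theorem group_generator_Rbounded_resolvent
    {X : Type*} [NormedAddCommGroup X] [NormedSpace ℂ X] [CompleteSpace X]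
    (T : ℝ → X →L[ℂ] X) (res : ℂ → X →L[ℂ] X) (w : ℝ)
    (hT0 : T 0 = ContinuousLinearMap.id ℂ X)
    (hTadd : ∀ s t : ℝ, T (s + t) = T s ∘L T t)
    (hTcont : ∀ x : X, Continuous fun t => T t x)
    (hgrowth : ∀ a : ℝ, w < a → ∃ M : ℝ, ∀ t : ℝ, ‖T t‖ ≤ M * Real.exp (a * |t|))
    (hlaplace_pos : ∀ lam : ℂ, w < lam.re → ∀ x : X,
      res lam x = ∫ t in Set.Ioi (0 : ℝ), Complex.exp (-(lam * t)) • T t x)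
    (hlaplace_neg : ∀ lam : ℂ, lam.re < -w → ∀ x : X,
      res lam x = -∫ t in Set.Ioi (0 : ℝ), Complex.exp (lam * t) • T (-t) x) :
    ∀ a : ℝ, w < a →
      ∃ C : ℝ, ∀ (m : ℕ) (lam : Fin m → ℂ),
        (∀ k, a ≤ |(lam k).re|) →
        ∀ x : Fin m → X,
          radAvg (fun k => res (lam k) (x k)) ≤ C * radAvg x ∧
          gaussAvg (fun k => res (lam k) (x k)) ≤ C * gaussAvg x := by
  intro a ha
  rcases subsingleton_or_nontrivial X with hX | hX
  · refine ⟨0, fun m lam _ x => ?_⟩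
    have hz : ∀ v : X, v = 0 := fun v => Subsingleton.elim _ _
    simp [radAvg, gaussAvg, hz]
  obtain ⟨b, hwb, hba⟩ := exists_between ha
  obtain ⟨M, hM⟩ := hgrowth b hwb
  have hb0 : 0 ≤ b := nonneg_of_group_growth hT0 hTadd hM
  set φ : ℝ → ℝ := fun t => M * Real.exp (-((a - b) * |t|)) with hφ
  have hφi : Integrable φ := (integrable_exp_neg_mul_abs (sub_pos.2 hba)).const_mul M
  set N : ℝ → X →L[ℂ] X := fun t => (Real.exp (-(a * |t|)) : ℂ) • T t with hN
  have hNc : ∀ x, Continuous fun t => N t x := fun x => by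
    have h := hTcont x
    simp only [hN, smul_apply]
    fun_prop
  have hNφ : ∀ t, ‖N t‖ ≤ φ t := fun t => by
    simp only [hN, hφ]
    rw [norm_smul, Complex.norm_real, Real.norm_of_nonneg (Real.exp_nonneg _)]
    calc _ ≤ Real.exp (-(a * |t|)) * (M * Real.exp (b * |t|)) := by gcongr; exact hM t
      _ = M * Real.exp (-((a - b) * |t|)) := by
        rw [mul_left_comm, ← Real.exp_add]; ring_nf
  have hrep : ∀ lam : ℂ, a ≤ |lam.re| → ∀ x,
      res lam x = ∫ t, resolventKernel a lam t • N t x := by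
    intro lam hlam x
    by_cases h : a ≤ lam.re
    · rw [hlaplace_pos lam (ha.trans_le h), ← integral_indicator measurableSet_Ioi]
      refine integral_congr_ae (.of_forall fun t => ?_)
      by_cases ht : 0 < t
      · simp only [Set.indicator, Set.mem_Ioi, ht, if_true, resolventKernel, h, hN,
          smul_apply, smul_smul, abs_of_pos ht]
        rw [Complex.ofReal_exp, ← Complex.exp_add]
        congr 2
        push_cast; ring
      · simp [Set.indicator, ht, resolventKernel, h]
    · have h3 : a ≤ -lam.re := (le_abs.1 hlam).resolve_left h
      have hsub := integral_comp_neg_Ioi (0 : ℝ) fun t => Complex.exp (-(lam * t)) • T t x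
      simp only [Complex.ofReal_neg, mul_neg, neg_neg, neg_zero] at hsub
      rw [hlaplace_neg lam (by linarith), hsub, ← integral_neg,
        ← integral_indicator measurableSet_Iic]
      refine integral_congr_ae (.of_forall fun t => ?_)
      by_cases ht : t ≤ 0
      · simp only [Set.indicator, Set.mem_Iic, ht, if_true, resolventKernel, h, if_false, hN,
          smul_apply, smul_smul, abs_of_nonpos ht, ← neg_smul]
        rw [Complex.ofReal_exp, neg_mul, ← Complex.exp_add]
        congr 3
        push_cast; ring
      · simp [Set.indicator, ht, resolventKernel, h]
  set K : ℝ := 2 * ∫ t, φ t with hK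
  have hφ0 : ∀ t, 0 ≤ φ t := fun t => (norm_nonneg _).trans (hNφ t)
  have hI0 : 0 ≤ ∫ t, φ t := integral_nonneg hφ0
  have hK0 : 0 ≤ K := by positivity
  have hKeq : 4 * (∫⁻ t, ENNReal.ofReal (φ t)) ^ 2 = ENNReal.ofReal (K ^ 2) := by
    rw [← ofReal_integral_eq_lintegral_ofReal hφi (.of_forall hφ0), hK, mul_pow,
      ENNReal.ofReal_mul (by norm_num), ENNReal.ofReal_pow hI0]
    norm_num
  have hφm : Measurable φ := by fun_prop
  refine ⟨K, fun m lam hlam x => ?_⟩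
  simp only [fun k => hrep (lam k) (hlam k) (x k)]
  exact ⟨radAvg_le_of_sqMoment_le hK0 (hKeq ▸ signSymmetric_rademacher.sqMoment_integral_le hNc hφm
      hφi hNφ (fun k => measurable_resolventKernel a (lam k))
      (fun k t => norm_resolventKernel_le (hlam k) t) x),
    gaussAvg_le_of_sqMoment_le hK0 (hKeq ▸ signSymmetric_gaussian.sqMoment_integral_le hNc hφm
      hφi hNφ (fun k => measurable_resolventKernel a (lam k))
      (fun k t => norm_resolventKernel_le (hlam k) t) x)⟩
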